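/- arXiv:2307.12818 — 9 statements merged into one kernel-verified Lean document; each statement's English description precedes it below -/
import Mathlib

section
/- The second-order Arakawa bracket is skew-symmetric: for all grid functions f and g and every grid point (i,j), J1(f,g)(i,j) = −J1(g,f)(i,j). -/
noncomputable def J1pp {N M : ℕ} (d : ℝ) (f g : ZMod N × ZMod M → ℝ) :
    ZMod N × ZMod M → ℝ := fun p =>
  (1 / (4 * d ^ 2)) *
    ((f (p.1 + 1, p.2) - f (p.1 - 1, p.2)) * (g (p.1, p.2 + 1) - g (p.1, p.2 - 1)) -
      (f (p.1, p.2 + 1) - f (p.1, p.2 - 1)) * (g (p.1 + 1, p.2) - g (p.1 - 1, p.2)))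

noncomputable def J1px {N M : ℕ} (d : ℝ) (f g : ZMod N × ZMod M → ℝ) :
    ZMod N × ZMod M → ℝ := fun p =>
  (1 / (4 * d ^ 2)) *
    (f (p.1 + 1, p.2) * (g (p.1 + 1, p.2 + 1) - g (p.1 + 1, p.2 - 1)) -
      f (p.1 - 1, p.2) * (g (p.1 - 1, p.2 + 1) - g (p.1 - 1, p.2 - 1)) -
      f (p.1, p.2 + 1) * (g (p.1 + 1, p.2 + 1) - g (p.1 - 1, p.2 + 1)) +
      f (p.1, p.2 - 1) * (g (p.1 + 1, p.2 - 1) - g (p.1 - 1, p.2 - 1)))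

noncomputable def J1xp {N M : ℕ} (d : ℝ) (f g : ZMod N × ZMod M → ℝ) :
    ZMod N × ZMod M → ℝ := fun p =>
  (1 / (4 * d ^ 2)) *
    (f (p.1 + 1, p.2 + 1) * (g (p.1, p.2 + 1) - g (p.1 + 1, p.2)) -
      f (p.1 - 1, p.2 - 1) * (g (p.1 - 1, p.2) - g (p.1, p.2 - 1)) -
      f (p.1 - 1, p.2 + 1) * (g (p.1, p.2 + 1) - g (p.1 - 1, p.2)) +
      f (p.1 + 1, p.2 - 1) * (g (p.1 + 1, p.2) - g (p.1, p.2 - 1)))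

/-- The second-order Arakawa bracket. -/
noncomputable def J1 {N M : ℕ} (d : ℝ) (f g : ZMod N × ZMod M → ℝ) :
    ZMod N × ZMod M → ℝ := fun p =>
  (1 / 3) * (J1pp d f g p + J1px d f g p + J1xp d f g p)

theorem J1pp_skew_symmetric {N M : ℕ} (d : ℝ) (f g : ZMod N × ZMod M → ℝ)
    (p : ZMod N × ZMod M) : J1pp d f g p = -J1pp d g f p := by
  unfold J1pp
  ring

theorem J1px_eq_neg_J1xp_swap {N M : ℕ} (d : ℝ) (f g : ZMod N × ZMod M → ℝ)
    (p : ZMod N × ZMod M) : J1px d f g p = -J1xp d g f p := by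
  unfold J1px J1xp
  ring

/-- The second-order Arakawa bracket is skew-symmetric. -/
theorem J1_skew_symmetric (N M : ℕ) [NeZero N] [NeZero M] (d : ℝ) (hd : 0 < d)
    (f g : ZMod N × ZMod M → ℝ) (p : ZMod N × ZMod M) :
    J1 d f g p = -J1 d g f p := by
  unfold J1
  rw [J1pp_skew_symmetric d f g p, J1px_eq_neg_J1xp_swap d f g p,
    J1px_eq_neg_J1xp_swap d g f p]
  ring
end

section
/- The second-order Arakawa bracket conserves mass: for all grid functions φ and f, the sum over all grid points of J1(φ,f)(i,j)·d² equals 0. -/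
theorem sum_grid_translate {N M : ℕ} [NeZero N] [NeZero M] (F : ZMod N × ZMod M → ℝ)
    (a : ZMod N) (b : ZMod M) :
    ∑ p : ZMod N × ZMod M, F (p.1 + a, p.2 + b) = ∑ p, F p :=
  Equiv.sum_comp (Equiv.addRight (a, b)) F

theorem sum_J1pp {N M : ℕ} [NeZero N] [NeZero M] (d : ℝ) (f g : ZMod N × ZMod M → ℝ) :
    ∑ p, J1pp d f g p = 0 := by
  have h₁ := sum_grid_translate (fun p ↦ f (p.1 + 1, p.2) * g (p.1, p.2 + 1)) (-1) (-1)
  have h₂ := sum_grid_translate (fun p ↦ f (p.1 + 1, p.2) * g (p.1, p.2 - 1)) (-1) 1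
  have h₃ := sum_grid_translate (fun p ↦ f (p.1 - 1, p.2) * g (p.1, p.2 + 1)) 1 (-1)
  have h₄ := sum_grid_translate (fun p ↦ f (p.1 - 1, p.2) * g (p.1, p.2 - 1)) 1 1
  simp only [← sub_eq_add_neg, sub_add_cancel, add_sub_cancel_right] at h₁ h₂ h₃ h₄
  simp only [J1pp, ← Finset.mul_sum, mul_sub, sub_mul, Finset.sum_sub_distrib]
  linear_combination (1 / (4 * d ^ 2)) * (-h₁ + h₂ + h₃ - h₄)

theorem sum_J1px {N M : ℕ} [NeZero N] [NeZero M] (d : ℝ) (f g : ZMod N × ZMod M → ℝ) :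
    ∑ p, J1px d f g p = 0 := by
  have h₁ := sum_grid_translate (fun p ↦ f p * (g (p.1, p.2 + 1) - g (p.1, p.2 - 1)))
  have h₂ := sum_grid_translate (fun p ↦ f p * (g (p.1 + 1, p.2) - g (p.1 - 1, p.2)))
  have h₁₁ := h₁ 1 0
  have h₁₂ := h₁ (-1) 0
  have h₂₁ := h₂ 0 1
  have h₂₂ := h₂ 0 (-1)
  simp only [← sub_eq_add_neg, add_zero] at h₁₁ h₁₂ h₂₁ h₂₂
  simp only [J1px, ← Finset.mul_sum, Finset.sum_add_distrib, Finset.sum_sub_distrib]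
  linear_combination (1 / (4 * d ^ 2)) * (h₁₁ - h₁₂ - h₂₁ + h₂₂)

theorem J1xp_eq_neg_J1px_swap {N M : ℕ} (d : ℝ) (f g : ZMod N × ZMod M → ℝ)
    (p : ZMod N × ZMod M) : J1xp d f g p = -J1px d g f p := by
  simp only [J1xp, J1px]
  ring

theorem sum_J1xp {N M : ℕ} [NeZero N] [NeZero M] (d : ℝ) (f g : ZMod N × ZMod M → ℝ) :
    ∑ p, J1xp d f g p = 0 := by
  simp only [J1xp_eq_neg_J1px_swap, Finset.sum_neg_distrib, sum_J1px, neg_zero]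


/-- The second-order Arakawa bracket conserves mass. -/
theorem J1_conserves_mass (N M : ℕ) [NeZero N] [NeZero M] (d : ℝ) (hd : 0 < d)
    (φ f : ZMod N × ZMod M → ℝ) :
    ∑ p : ZMod N × ZMod M, J1 d φ f p * d ^ 2 = 0 := by
  simp only [J1, ← Finset.sum_mul, ← Finset.mul_sum, Finset.sum_add_distrib, sum_J1pp, sum_J1px,
    sum_J1xp, add_zero, mul_zero, zero_mul]
end

section
/- The second-order Arakawa bracket conserves the discrete L²-norm: for all grid functions φ and f, the sum over all grid points of f(i,j)·J1(φ,f)(i,j)·d² equals 0. -/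
/-- Differences by a translation sum to zero over a finite group. -/
theorem sum_sub_translate {G R : Type*} [AddGroup G] [Fintype G] [AddCommGroup R]
    (H : G → R) (b : G) : ∑ p, (H p - H (p - b)) = 0 := by
  rw [Finset.sum_sub_distrib, sub_eq_zero]
  exact ((Equiv.subRight b).sum_comp H).symm

/-- The exchange of `f ^ 2` between `(i, j)` and `(i + 1, j)`. -/
def fluxX {N M : ℕ} (φ f : ZMod N × ZMod M → ℝ) (p : ZMod N × ZMod M) : ℝ :=
  f p * f (p.1 + 1, p.2) *
    (φ (p.1, p.2 - 1) - φ (p.1, p.2 + 1) + φ (p.1 + 1, p.2 - 1) - φ (p.1 + 1, p.2 + 1))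

/-- The exchange of `f ^ 2` between `(i, j)` and `(i, j + 1)`. -/
def fluxY {N M : ℕ} (φ f : ZMod N × ZMod M → ℝ) (p : ZMod N × ZMod M) : ℝ :=
  f p * f (p.1, p.2 + 1) *
    (φ (p.1 + 1, p.2) - φ (p.1 - 1, p.2) + φ (p.1 + 1, p.2 + 1) - φ (p.1 - 1, p.2 + 1))

/-- The exchange of `f ^ 2` between `(i, j)` and `(i + 1, j + 1)`. -/
def fluxDiag {N M : ℕ} (φ f : ZMod N × ZMod M → ℝ) (p : ZMod N × ZMod M) : ℝ :=
  f p * f (p.1 + 1, p.2 + 1) * (φ (p.1 + 1, p.2) - φ (p.1, p.2 + 1))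

/-- The exchange of `f ^ 2` between `(i, j)` and `(i + 1, j - 1)`. -/
def fluxAnti {N M : ℕ} (φ f : ZMod N × ZMod M → ℝ) (p : ZMod N × ZMod M) : ℝ :=
  f p * f (p.1 + 1, p.2 - 1) * (φ (p.1, p.2 - 1) - φ (p.1 + 1, p.2))

/-- The second-order Arakawa bracket conserves the discrete `L²`-norm. -/
theorem J1_conserves_L2 (N M : ℕ) [NeZero N] [NeZero M] (d : ℝ) (hd : 0 < d)
    (φ f : ZMod N × ZMod M → ℝ) :
    ∑ p : ZMod N × ZMod M, f p * J1 d φ f p * d ^ 2 = 0 := by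
  have summand_eq_flux : ∀ p, f p * J1 d φ f p * d ^ 2 = 1 / 12 * (
      (fluxX φ f p - fluxX φ f (p - (1, 0))) + (fluxY φ f p - fluxY φ f (p - (0, 1))) +
      (fluxDiag φ f p - fluxDiag φ f (p - (1, 1))) +
      (fluxAnti φ f p - fluxAnti φ f (p - (1, -1)))) := by
    rintro ⟨i, j⟩
    simp only [J1, J1pp, J1px, J1xp, fluxX, fluxY, fluxDiag, fluxAnti, Prod.mk_sub_mk,
      sub_zero, sub_neg_eq_add, sub_add_cancel, add_sub_cancel_right]
    field_simp
    ring
  simp only [summand_eq_flux, ← Finset.mul_sum, Finset.sum_add_distrib, sum_sub_translate,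
    add_zero, mul_zero]
end

section
/- The second-order Arakawa bracket conserves the discrete energy: for all grid functions φ and f, the sum over all grid points of φ(i,j)·J1(φ,f)(i,j)·d² equals 0. -/
theorem sum_mul_shift {G : Type*} [AddGroup G] [Fintype G] (A f : G → ℝ) (b : G) :
    ∑ p, A p * f (p + b) = ∑ p, A (p - b) * f p :=
  Fintype.sum_equiv (Equiv.addRight b) _ _ fun p => by simp

/-- The second-order Arakawa bracket conserves the discrete energy. -/
theorem J1_conserves_energy (N M : ℕ) [NeZero N] [NeZero M] (d : ℝ) (hd : 0 < d)
    (φ f : ZMod N × ZMod M → ℝ) :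
    ∑ p : ZMod N × ZMod M, φ p * J1 d φ f p * d ^ 2 = 0 := by
  let E : ZMod N × ZMod M := (1, 0)
  let F : ZMod N × ZMod M := (0, 1)
  have expand : ∀ p, φ p * J1 d φ f p * d ^ 2 = (1 / 12) *
      (φ p * (φ (p + E) - φ (p - E) + φ (p + E + F) - φ (p - E + F)) * f (p + F) +
       φ p * (φ (p - E) - φ (p + E) + φ (p - E - F) - φ (p + E - F)) * f (p + -F) +
       φ p * (φ (p - F) - φ (p + F) + φ (p + E - F) - φ (p + E + F)) * f (p + E) +
       φ p * (φ (p + F) - φ (p - F) + φ (p - E + F) - φ (p - E - F)) * f (p + -E) +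
       φ p * (φ (p + E) - φ (p + F)) * f (p + (E + F)) +
       φ p * (φ (p - F) - φ (p + E)) * f (p + (E - F)) +
       φ p * (φ (p + F) - φ (p - E)) * f (p + (F - E)) +
       φ p * (φ (p - E) - φ (p - F)) * f (p + (-E - F))) := by
    rintro ⟨x, y⟩
    simp only [J1, J1pp, J1px, J1xp, E, F, Prod.mk_add_mk, Prod.mk_sub_mk, Prod.neg_mk,
      add_zero, sub_zero, zero_sub, zero_add, neg_zero, ← sub_eq_add_neg]
    field_simp
    ring
  simp_rw [expand, ← Finset.mul_sum, Finset.sum_add_distrib]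
  rw [sum_mul_shift (fun p => φ p * (φ (p + E) - φ (p - E) + φ (p + E + F) - φ (p - E + F))),
    sum_mul_shift (fun p => φ p * (φ (p - E) - φ (p + E) + φ (p - E - F) - φ (p + E - F))),
    sum_mul_shift (fun p => φ p * (φ (p - F) - φ (p + F) + φ (p + E - F) - φ (p + E + F))),
    sum_mul_shift (fun p => φ p * (φ (p + F) - φ (p - F) + φ (p - E + F) - φ (p - E - F))),
    sum_mul_shift (fun p => φ p * (φ (p + E) - φ (p + F))),
    sum_mul_shift (fun p => φ p * (φ (p - F) - φ (p + E))),
    sum_mul_shift (fun p => φ p * (φ (p + F) - φ (p - E))),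
    sum_mul_shift (fun p => φ p * (φ (p - E) - φ (p - F)))]
  simp_rw [← Finset.sum_add_distrib]
  rw [Finset.sum_eq_zero, mul_zero]
  rintro ⟨x, y⟩ -
  simp only [E, F, Prod.mk_add_mk, Prod.mk_sub_mk, Prod.neg_mk, add_zero, sub_zero, zero_sub,
    zero_add, neg_zero, sub_neg_eq_add, add_sub_cancel_right, sub_add_cancel]
  ring
end

section
/- The fourth-order Arakawa bracket is skew-symmetric: for all grid functions f and g and every grid point (i,j), Jh(f,g)(i,j) = −Jh(g,f)(i,j). -/
noncomputable def J2xx {N M : ℕ} (d : ℝ) (f g : ZMod N × ZMod M → ℝ) :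
    ZMod N × ZMod M → ℝ := fun p =>
  (1 / (8 * d ^ 2)) *
    ((f (p.1 + 1, p.2 + 1) - f (p.1 - 1, p.2 - 1)) * (g (p.1 - 1, p.2 + 1) - g (p.1 + 1, p.2 - 1)) -
      (f (p.1 - 1, p.2 + 1) - f (p.1 + 1, p.2 - 1)) * (g (p.1 + 1, p.2 + 1) - g (p.1 - 1, p.2 - 1)))

noncomputable def J2xp {N M : ℕ} (d : ℝ) (f g : ZMod N × ZMod M → ℝ) :
    ZMod N × ZMod M → ℝ := fun p =>
  (1 / (8 * d ^ 2)) *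
    (f (p.1 + 1, p.2 + 1) * (g (p.1, p.2 + 2) - g (p.1 + 2, p.2)) -
      f (p.1 - 1, p.2 - 1) * (g (p.1 - 2, p.2) - g (p.1, p.2 - 2)) -
      f (p.1 - 1, p.2 + 1) * (g (p.1, p.2 + 2) - g (p.1 - 2, p.2)) +
      f (p.1 + 1, p.2 - 1) * (g (p.1 + 2, p.2) - g (p.1, p.2 - 2)))

noncomputable def J2px {N M : ℕ} (d : ℝ) (f g : ZMod N × ZMod M → ℝ) :
    ZMod N × ZMod M → ℝ := fun p =>
  (1 / (8 * d ^ 2)) *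
    (f (p.1 + 2, p.2) * (g (p.1 + 1, p.2 + 1) - g (p.1 + 1, p.2 - 1)) -
      f (p.1 - 2, p.2) * (g (p.1 - 1, p.2 + 1) - g (p.1 - 1, p.2 - 1)) -
      f (p.1, p.2 + 2) * (g (p.1 + 1, p.2 + 1) - g (p.1 - 1, p.2 + 1)) +
      f (p.1, p.2 - 2) * (g (p.1 + 1, p.2 - 1) - g (p.1 - 1, p.2 - 1)))

noncomputable def J2 {N M : ℕ} (d : ℝ) (f g : ZMod N × ZMod M → ℝ) :
    ZMod N × ZMod M → ℝ := fun p =>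
  (1 / 3) * (J2xx d f g p + J2xp d f g p + J2px d f g p)

/-- The fourth-order Arakawa bracket. -/
noncomputable def Jh {N M : ℕ} (d : ℝ) (f g : ZMod N × ZMod M → ℝ) :
    ZMod N × ZMod M → ℝ := fun p =>
  2 * J1 d f g p - J2 d f g p

/-- The fourth-order Arakawa bracket is skew-symmetric. -/
theorem Jh_skew_symmetric (N M : ℕ) [NeZero N] [NeZero M] (d : ℝ) (hd : 0 < d)
    (f g : ZMod N × ZMod M → ℝ) (p : ZMod N × ZMod M) :
    Jh d f g p = -Jh d g f p := by
  simp only [Jh, J1, J1pp, J1px, J1xp, J2, J2xx, J2xp, J2px]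
  ring
end

section
/- The fourth-order Arakawa bracket conserves mass: for all grid functions φ and f, the sum over all grid points of Jh(φ,f)(i,j)·d² equals 0. -/
/-- The periodic cross-correlation of `f` and `g` at offset `v`. -/
def crossCorrelation {G R : Type*} [Add G] [Fintype G] [NonUnitalNonAssocSemiring R]
    (f g : G → R) (v : G) : R :=
  ∑ p, f p * g (p + v)

theorem sum_translate_mul_translate {G R : Type*} [AddCommGroup G] [Fintype G]
    [NonUnitalNonAssocSemiring R] (f g : G → R) (u v : G) :
    ∑ p, f (p + u) * g (p + v) = crossCorrelation f g (v - u) :=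
  Fintype.sum_equiv (Equiv.addRight u) _ _ fun p => by
    simp only [Equiv.coe_addRight]
    congr 2
    abel

theorem mk_fst_add_snd_add {A B : Type*} [Add A] [Add B] (p : A × B) (a : A) (b : B) :
    (p.1 + a, p.2 + b) = p + (a, b) := rfl

theorem mk_fst_add_snd {A B : Type*} [Add A] [AddZeroClass B] (p : A × B) (a : A) :
    (p.1 + a, p.2) = p + (a, 0) := by
  ext <;> simp

theorem mk_fst_snd_add {A B : Type*} [AddZeroClass A] [Add B] (p : A × B) (b : B) :
    (p.1, p.2 + b) = p + (0, b) := by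
  ext <;> simp

theorem sum_J2xx {N M : ℕ} [NeZero N] [NeZero M] (d : ℝ) (f g : ZMod N × ZMod M → ℝ) :
    ∑ p, J2xx d f g p = 0 := by
  simp only [J2xx, ← Finset.mul_sum, sub_eq_add_neg, mk_fst_add_snd_add, mul_add, add_mul,
    neg_mul, mul_neg, neg_add, neg_neg, Finset.sum_add_distrib, Finset.sum_neg_distrib,
    sum_translate_mul_translate, Prod.neg_mk, Prod.mk_add_mk]
  ring_nf

theorem sum_J2xp {N M : ℕ} [NeZero N] [NeZero M] (d : ℝ) (f g : ZMod N × ZMod M → ℝ) :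
    ∑ p, J2xp d f g p = 0 := by
  simp only [J2xp, ← Finset.mul_sum, sub_eq_add_neg, mk_fst_add_snd_add, mk_fst_add_snd,
    mk_fst_snd_add, mul_add, mul_neg, neg_add, neg_neg, Finset.sum_add_distrib,
    Finset.sum_neg_distrib, sum_translate_mul_translate, Prod.neg_mk, Prod.mk_add_mk]
  ring_nf

theorem sum_J2px {N M : ℕ} [NeZero N] [NeZero M] (d : ℝ) (f g : ZMod N × ZMod M → ℝ) :
    ∑ p, J2px d f g p = 0 := by
  simp only [J2px, ← Finset.mul_sum, sub_eq_add_neg, mk_fst_add_snd_add, mk_fst_add_snd,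
    mk_fst_snd_add, mul_add, mul_neg, neg_add, neg_neg, Finset.sum_add_distrib,
    Finset.sum_neg_distrib, sum_translate_mul_translate, Prod.neg_mk, Prod.mk_add_mk]
  ring_nf

/-- The fourth-order Arakawa bracket conserves mass. -/
theorem Jh_conserves_mass (N M : ℕ) [NeZero N] [NeZero M] (d : ℝ) (hd : 0 < d)
    (φ f : ZMod N × ZMod M → ℝ) :
    ∑ p : ZMod N × ZMod M, Jh d φ f p * d ^ 2 = 0 := by
  simp only [← Finset.sum_mul, Jh, J1, J2, Finset.sum_sub_distrib, ← Finset.mul_sum,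
    Finset.sum_add_distrib, sum_J1pp, sum_J1px, sum_J1xp, sum_J2xx, sum_J2xp, sum_J2px]
  ring
end

section
/- The fourth-order Arakawa bracket conserves the discrete L²-norm: for all grid functions φ and f, the sum over all grid points of f(i,j)·Jh(φ,f)(i,j)·d² equals 0. -/
/-- A discrete divergence `F - F (· - b)` on a finite additive group has total sum zero. -/
theorem sum_sub_translate_eq_zero {G : Type*} [AddGroup G] [Fintype G] (F : G → ℝ) (b : G) :
    ∑ p, (F p - F (p - b)) = 0 := by
  rw [Finset.sum_sub_distrib, sub_eq_zero]
  exact ((Equiv.subRight b).sum_comp F).symm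

/-- The local density `f * Jh d φ f * d ^ 2` is a sum of discrete divergences along the directions
`(1, 0)`, `(0, 1)`, `(1, 1)`, `(1, -1)`, `(2, 0)` and `(0, 2)`. -/
theorem exists_flux_mul_Jh {N M : ℕ} {d : ℝ} (hd : d ≠ 0) (φ f : ZMod N × ZMod M → ℝ) :
    ∃ F₁ F₂ F₃ F₄ F₅ F₆ : ZMod N × ZMod M → ℝ, ∀ p, f p * Jh d φ f p * d ^ 2 =
      (F₁ p - F₁ (p - (1, 0))) + (F₂ p - F₂ (p - (0, 1))) + (F₃ p - F₃ (p - (1, 1))) +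
      (F₄ p - F₄ (p - (1, -1))) + (F₅ p - F₅ (p - (2, 0))) + (F₆ p - F₆ (p - (0, 2))) := by
  refine ⟨
    fun p => f p * f (p.1 + 1, p.2) / 6 * (φ (p.1, p.2 - 1) - φ (p.1, p.2 + 1) +
      φ (p.1 + 1, p.2 - 1) - φ (p.1 + 1, p.2 + 1)),
    fun p => f p * f (p.1, p.2 + 1) / 6 * (φ (p.1 + 1, p.2) - φ (p.1 - 1, p.2) +
      φ (p.1 + 1, p.2 + 1) - φ (p.1 - 1, p.2 + 1)),
    fun p => f p * f (p.1 + 1, p.2 + 1) * ((φ (p.1 + 1, p.2) - φ (p.1, p.2 + 1)) / 6 -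
      (φ (p.1 + 1, p.2 - 1) - φ (p.1 - 1, p.2 + 1) + φ (p.1 + 2, p.2) - φ (p.1, p.2 + 2)) / 24),
    fun p => f p * f (p.1 + 1, p.2 - 1) * ((φ (p.1, p.2 - 1) - φ (p.1 + 1, p.2)) / 6 -
      (φ (p.1 - 1, p.2 - 1) - φ (p.1 + 1, p.2 + 1) + φ (p.1, p.2 - 2) - φ (p.1 + 2, p.2)) / 24),
    fun p => -(f p * f (p.1 + 2, p.2) / 24 * (φ (p.1 + 1, p.2 - 1) - φ (p.1 + 1, p.2 + 1))),
    fun p => -(f p * f (p.1, p.2 + 2) / 24 * (φ (p.1 + 1, p.2 + 1) - φ (p.1 - 1, p.2 + 1))), ?_⟩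
  rintro ⟨x, y⟩
  have sub_one_sub_one {n : ℕ} (z : ZMod n) : z - 1 - 1 = z - 2 := by ring
  have sub_one_add_two {n : ℕ} (z : ZMod n) : z - 1 + 2 = z + 1 := by ring
  have sub_two_add_one {n : ℕ} (z : ZMod n) : z - 2 + 1 = z - 1 := by ring
  have add_one_add_one {n : ℕ} (z : ZMod n) : z + 1 + 1 = z + 2 := by ring
  have add_one_sub_two {n : ℕ} (z : ZMod n) : z + 1 - 2 = z - 1 := by ring
  simp only [Jh, J1, J1pp, J1px, J1xp, J2, J2xx, J2xp, J2px, Prod.mk_sub_mk, sub_zero,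
    sub_neg_eq_add, sub_add_cancel, add_sub_cancel_right, sub_one_sub_one, sub_one_add_two,
    sub_two_add_one, add_one_add_one, add_one_sub_two]
  field_simp
  ring

/-- The fourth-order Arakawa bracket conserves the discrete `L²`-norm. -/
theorem Jh_conserves_L2 (N M : ℕ) [NeZero N] [NeZero M] (d : ℝ) (hd : 0 < d)
    (φ f : ZMod N × ZMod M → ℝ) :
    ∑ p : ZMod N × ZMod M, f p * Jh d φ f p * d ^ 2 = 0 := by
  obtain ⟨F₁, F₂, F₃, F₄, F₅, F₆, h⟩ := exists_flux_mul_Jh hd.ne' φ f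
  simp only [h, Finset.sum_add_distrib, sum_sub_translate_eq_zero, add_zero]
end

section
/- The fourth-order Arakawa bracket conserves the discrete energy: for all grid functions φ and f, the sum over all grid points of φ(i,j)·Jh(φ,f)(i,j)·d² equals 0. -/
/-- A difference of fluxes along a fixed shift of a finite group is orthogonal to the potential. -/
theorem sum_mul_flux_sub_eq_zero {G : Type*} [AddCommGroup G] [Fintype G]
    (φ g : G → ℝ) (a : G) :
    ∑ p, φ p * (φ (p + a) * g p - φ (p - a) * g (p - a)) = 0 := by
  have h : ∑ p, φ p * φ (p - a) * g (p - a) = ∑ p, φ (p + a) * φ p * g p := by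
    rw [← Equiv.sum_comp (Equiv.addRight a)]
    simp
  simp only [mul_sub, Finset.sum_sub_distrib, ← mul_assoc, h, sub_eq_zero]
  exact Finset.sum_congr rfl fun p _ => by ring

/-- The bracket `Jh d φ f`, multiplied by `φ`, is a combination of flux differences along the
six shifts `(1, 0)`, `(0, 1)`, `(1, 1)`, `(1, -1)`, `(2, 0)` and `(0, 2)`. -/
theorem mul_Jh_eq_flux_sub {N M : ℕ} (d : ℝ) (φ f : ZMod N × ZMod M → ℝ) :
    ∃ g₁ g₂ g₃ g₄ g₅ g₆ : ZMod N × ZMod M → ℝ, ∀ p, φ p * Jh d φ f p = 1 / (24 * d ^ 2) *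
      (φ p * (φ (p + (1, 0)) * g₁ p - φ (p - (1, 0)) * g₁ (p - (1, 0))) +
        φ p * (φ (p + (0, 1)) * g₂ p - φ (p - (0, 1)) * g₂ (p - (0, 1))) +
        φ p * (φ (p + (1, 1)) * g₃ p - φ (p - (1, 1)) * g₃ (p - (1, 1))) +
        φ p * (φ (p + (1, -1)) * g₄ p - φ (p - (1, -1)) * g₄ (p - (1, -1))) +
        φ p * (φ (p + (2, 0)) * g₅ p - φ (p - (2, 0)) * g₅ (p - (2, 0))) +
        φ p * (φ (p + (0, 2)) * g₆ p - φ (p - (0, 2)) * g₆ (p - (0, 2)))) := by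
  refine ⟨
    fun p => 4 * (f (p.1, p.2 + 1) - f (p.1, p.2 - 1) +
      f (p.1 + 1, p.2 + 1) - f (p.1 + 1, p.2 - 1)),
    fun p => -4 * (f (p.1 + 1, p.2) - f (p.1 - 1, p.2) +
      f (p.1 + 1, p.2 + 1) - f (p.1 - 1, p.2 + 1)),
    fun p => 4 * (f (p.1, p.2 + 1) - f (p.1 + 1, p.2)) -
      (f (p.1 - 1, p.2 + 1) - f (p.1 + 1, p.2 - 1) + f (p.1, p.2 + 2) - f (p.1 + 2, p.2)),
    fun p => 4 * (f (p.1 + 1, p.2) - f (p.1, p.2 - 1)) -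
      (f (p.1 + 1, p.2 + 1) - f (p.1 - 1, p.2 - 1) + f (p.1 + 2, p.2) - f (p.1, p.2 - 2)),
    fun p => -(f (p.1 + 1, p.2 + 1) - f (p.1 + 1, p.2 - 1)),
    fun p => f (p.1 + 1, p.2 + 1) - f (p.1 - 1, p.2 + 1), ?_⟩
  rintro ⟨i, j⟩
  have add_one_add_one {n : ℕ} (x : ZMod n) : x + 1 + 1 = x + 2 := by ring
  have sub_one_sub_one {n : ℕ} (x : ZMod n) : x - 1 - 1 = x - 2 := by ring
  have sub_two_add_one {n : ℕ} (x : ZMod n) : x - 2 + 1 = x - 1 := by ring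
  have sub_one_add_two {n : ℕ} (x : ZMod n) : x - 1 + 2 = x + 1 := by ring
  have add_one_sub_two {n : ℕ} (x : ZMod n) : x + 1 - 2 = x - 1 := by ring
  simp only [Jh, J1, J1pp, J1px, J1xp, J2, J2xx, J2xp, J2px, Prod.mk_add_mk, Prod.mk_sub_mk,
    add_zero, sub_zero, sub_neg_eq_add, ← sub_eq_add_neg, sub_add_cancel, add_sub_cancel_right,
    add_one_add_one, sub_one_sub_one, sub_two_add_one, sub_one_add_two, add_one_sub_two]
  ring

/-- The fourth-order Arakawa bracket conserves the discrete energy. -/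
theorem Jh_conserves_energy (N M : ℕ) [NeZero N] [NeZero M] (d : ℝ) (hd : 0 < d)
    (φ f : ZMod N × ZMod M → ℝ) :
    ∑ p : ZMod N × ZMod M, φ p * Jh d φ f p * d ^ 2 = 0 := by
  obtain ⟨g₁, g₂, g₃, g₄, g₅, g₆, h⟩ := mul_Jh_eq_flux_sub d φ f
  simp only [h, ← Finset.sum_mul, ← Finset.mul_sum, Finset.sum_add_distrib,
    sum_mul_flux_sub_eq_zero, add_zero, mul_zero, zero_mul]
end

section
/- Semi-discrete conservation for the Arakawa-discretized poloidal step: fix a grid function φ and let f : ℝ → (ZMod N × ZMod M → ℝ) be such that for every grid point (i,j) the map t ↦ f(t)(i,j) is differentiable with derivative equal to −Jh(φ, f(t))(i,j) at every time t. Then the discrete mass t ↦ ∑_{(i,j)} f(t)(i,j)·d², the discrete L²-norm t ↦ ∑_{(i,j)} f(t)(i,j)²·d², and the discrete energy t ↦ ∑_{(i,j)} φ(i,j)·f(t)(i,j)·d² are all constant functions of t. -/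
/-- The bracket generated by the triangle with vertices `0`, `a`, `b`: pairing it with `h` sums the
determinants of the values of `h`, `f`, `g` over all translates of the triangle. -/
def triangleBracket {G : Type*} [AddCommGroup G] (a b : G) (f g : G → ℝ) (p : G) : ℝ :=
  f (p + a) * g (p + b) - f (p + b) * g (p + a) +
    (f (p + (b - a)) * g (p - a) - f (p - a) * g (p + (b - a))) +
    (f (p - b) * g (p + (a - b)) - f (p + (a - b)) * g (p - b))

/-- The sum of the triangle brackets over the four triangles obtained from `0`, `a`, `b` by the
rotation `a ↦ b ↦ -a`. -/
def rotatedBracket {G : Type*} [AddCommGroup G] (a b : G) (f g : G → ℝ) (p : G) : ℝ :=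
  triangleBracket a b f g p + triangleBracket b (-a) f g p +
    triangleBracket (-a) (-b) f g p + triangleBracket (-b) a f g p

section FiniteGroup

variable {G : Type*} [AddCommGroup G] [Fintype G]

theorem sum_mul_triangleBracket (a b : G) (f g h : G → ℝ) :
    ∑ p, h p * triangleBracket a b f g p =
      ∑ p, (h p * (f (p + a) * g (p + b) - f (p + b) * g (p + a)) +
        h (p + a) * (f (p + b) * g p - f p * g (p + b)) +
        h (p + b) * (f p * g (p + a) - f (p + a) * g p)) := by
  have ha := Equiv.sum_comp (Equiv.addRight a) fun p =>
    h p * (f (p + (b - a)) * g (p - a) - f (p - a) * g (p + (b - a)))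
  have hb := Equiv.sum_comp (Equiv.addRight b) fun p =>
    h p * (f (p - b) * g (p + (a - b)) - f (p + (a - b)) * g (p - b))
  simp only [Equiv.coe_addRight, add_sub_cancel_right, add_assoc, add_sub_cancel] at ha hb
  simp only [triangleBracket, mul_add, Finset.sum_add_distrib, ha, hb]

theorem sum_left_mul_rotatedBracket (a b : G) (f g : G → ℝ) :
    ∑ p, f p * rotatedBracket a b f g p = 0 := by
  have key (a b : G) : ∑ p, f p * triangleBracket a b f g p = 0 := by
    rw [sum_mul_triangleBracket]
    exact Finset.sum_eq_zero fun p _ => by ring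
  simp only [rotatedBracket, mul_add, Finset.sum_add_distrib, key, add_zero]

theorem sum_right_mul_rotatedBracket (a b : G) (f g : G → ℝ) :
    ∑ p, g p * rotatedBracket a b f g p = 0 := by
  have key (a b : G) : ∑ p, g p * triangleBracket a b f g p = 0 := by
    rw [sum_mul_triangleBracket]
    exact Finset.sum_eq_zero fun p _ => by ring
  simp only [rotatedBracket, mul_add, Finset.sum_add_distrib, key, add_zero]

theorem sum_rotatedBracket (a b : G) (f g : G → ℝ) :
    ∑ p, rotatedBracket a b f g p = 0 := by
  obtain ⟨C, hC⟩ : ∃ C : G → ℝ, ∀ u v, ∑ p, f (p + u) * g (p + v) = C (v - u) := by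
    refine ⟨fun w => ∑ p, f p * g (p + w), fun u v => ?_⟩
    have h := Equiv.sum_comp (Equiv.addRight u) fun p => f p * g (p + (v - u))
    simpa only [Equiv.coe_addRight, add_assoc, add_sub_cancel] using h
  simp only [rotatedBracket, triangleBracket, sub_eq_add_neg _ a, sub_eq_add_neg _ b,
    sub_eq_add_neg _ (-a), sub_eq_add_neg _ (-b), Finset.sum_add_distrib,
    Finset.sum_sub_distrib, hC]
  abel_nf

end FiniteGroup

section Arakawa

variable {N M : ℕ}

theorem J1_eq_rotatedBracket (d : ℝ) (f g : ZMod N × ZMod M → ℝ) (p : ZMod N × ZMod M) :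
    J1 d f g p = 1 / (12 * d ^ 2) * rotatedBracket (1, 0) (0, 1) f g p := by
  obtain ⟨i, j⟩ := p
  simp only [J1, J1pp, J1px, J1xp, rotatedBracket, triangleBracket, Prod.mk_add_mk,
    Prod.mk_sub_mk, Prod.neg_mk]
  ring_nf

theorem J2_eq_rotatedBracket (d : ℝ) (f g : ZMod N × ZMod M → ℝ) (p : ZMod N × ZMod M) :
    J2 d f g p = 1 / (24 * d ^ 2) * rotatedBracket (1, 1) (-1, 1) f g p := by
  obtain ⟨i, j⟩ := p
  simp only [J2, J2xx, J2px, J2xp, rotatedBracket, triangleBracket, Prod.mk_add_mk,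
    Prod.mk_sub_mk, Prod.neg_mk]
  ring_nf

theorem Jh_eq_rotatedBracket (d : ℝ) (f g : ZMod N × ZMod M → ℝ) (p : ZMod N × ZMod M) :
    Jh d f g p = 2 * (1 / (12 * d ^ 2)) * rotatedBracket (1, 0) (0, 1) f g p -
      1 / (24 * d ^ 2) * rotatedBracket (1, 1) (-1, 1) f g p := by
  rw [Jh, J1_eq_rotatedBracket, J2_eq_rotatedBracket, mul_assoc]

variable [NeZero N] [NeZero M]

theorem sum_Jh (d : ℝ) (f g : ZMod N × ZMod M → ℝ) : ∑ p, Jh d f g p = 0 := by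
  simp only [Jh_eq_rotatedBracket, Finset.sum_sub_distrib, ← Finset.mul_sum,
    sum_rotatedBracket, mul_zero, sub_zero]

theorem sum_left_mul_Jh (d : ℝ) (f g : ZMod N × ZMod M → ℝ) : ∑ p, f p * Jh d f g p = 0 := by
  simp only [Jh_eq_rotatedBracket, mul_sub, mul_left_comm (f _), Finset.sum_sub_distrib,
    ← Finset.mul_sum, sum_left_mul_rotatedBracket, mul_zero, sub_zero]

theorem sum_right_mul_Jh (d : ℝ) (f g : ZMod N × ZMod M → ℝ) : ∑ p, g p * Jh d f g p = 0 := by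
  simp only [Jh_eq_rotatedBracket, mul_sub, mul_left_comm (g _), Finset.sum_sub_distrib,
    ← Finset.mul_sum, sum_right_mul_rotatedBracket, mul_zero, sub_zero]

end Arakawa

theorem eq_of_forall_hasDerivAt_zero {F : ℝ → ℝ} (hF : ∀ t, HasDerivAt F 0 t) (t₁ t₂ : ℝ) :
    F t₁ = F t₂ :=
  is_const_of_deriv_eq_zero (fun t => (hF t).differentiableAt) (fun t => (hF t).deriv) t₁ t₂

/-- Semi-discrete conservation for the Arakawa-discretized poloidal step:
the discrete mass, discrete `L²`-norm, and discrete energy are constant in time. -/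
theorem semidiscrete_arakawa_conservation (N M : ℕ) [NeZero N] [NeZero M]
    (d : ℝ) (hd : 0 < d) (φ : ZMod N × ZMod M → ℝ)
    (f : ℝ → ZMod N × ZMod M → ℝ)
    (hf : ∀ (p : ZMod N × ZMod M) (t : ℝ),
      HasDerivAt (fun s => f s p) (-Jh d φ (f t) p) t) :
    (∀ t₁ t₂ : ℝ, ∑ p : ZMod N × ZMod M, f t₁ p * d ^ 2 =
        ∑ p : ZMod N × ZMod M, f t₂ p * d ^ 2) ∧
    (∀ t₁ t₂ : ℝ, ∑ p : ZMod N × ZMod M, (f t₁ p) ^ 2 * d ^ 2 =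
        ∑ p : ZMod N × ZMod M, (f t₂ p) ^ 2 * d ^ 2) ∧
    (∀ t₁ t₂ : ℝ, ∑ p : ZMod N × ZMod M, φ p * f t₁ p * d ^ 2 =
        ∑ p : ZMod N × ZMod M, φ p * f t₂ p * d ^ 2) := by
  refine ⟨eq_of_forall_hasDerivAt_zero fun t => ?_, eq_of_forall_hasDerivAt_zero fun t => ?_,
    eq_of_forall_hasDerivAt_zero fun t => ?_⟩
  · refine (HasDerivAt.fun_sum fun p _ => (hf p t).mul_const (d ^ 2)).congr_deriv ?_
    rw [← Finset.sum_mul, Finset.sum_neg_distrib, sum_Jh, neg_zero, zero_mul]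
  · refine (HasDerivAt.fun_sum fun p _ => ((hf p t).fun_pow 2).mul_const (d ^ 2)).congr_deriv ?_
    calc _ = ∑ p, (-2 * d ^ 2) * (f t p * Jh d φ (f t) p) :=
          Finset.sum_congr rfl fun p _ => by push_cast; ring
      _ = 0 := by rw [← Finset.mul_sum, sum_right_mul_Jh, mul_zero]
  · refine (HasDerivAt.fun_sum fun p _ =>
      ((hf p t).const_mul (φ p)).mul_const (d ^ 2)).congr_deriv ?_
    calc _ = ∑ p, (-d ^ 2) * (φ p * Jh d φ (f t) p) :=
          Finset.sum_congr rfl fun p _ => by ring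
      _ = 0 := by rw [← Finset.mul_sum, sum_left_mul_Jh, mul_zero]
end
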